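/- Let P be a transition kernel, π₁ and π₂ two policies, and R : S × A → ℝ a reward function with |R(s,a)| ≤ R_max for all (s,a). Then |V(π₁, P, R) − V(π₂, P, R)| ≤ (2 R_max / (1−γ)²) · max_{s∈S} D_TV(π₁(s), π₂(s)). (Return bound for two policies in the same environment, used to convert representation-induced policy deviations into return gaps.) -/

import Mathlib

open scoped BigOperators

/-- Total variation distance between two PMFs on a finite type. -/
noncomputable def DTV {α : Type*} [Fintype α] (p q : PMF α) : ℝ :=
  (1 / 2) * ∑ x, |(p x).toReal - (q x).toReal|

/-- The time-`t` state–action distribution of policy `π` in the MDP with transition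
kernel `P` and initial state distribution `ρ₀`. -/
noncomputable def stateActionDist {S A : Type*} (π : S → PMF A) (P : S × A → PMF S)
    (ρ₀ : PMF S) : ℕ → PMF (S × A)
  | 0 => ρ₀.bind fun s => (π s).map fun a => (s, a)
  | (t + 1) => (stateActionDist π P ρ₀ t).bind fun sa =>
      (P sa).bind fun s' => (π s').map fun a' => (s', a')

/-- The expected discounted return of policy `π` under transition kernel `P`,
initial distribution `ρ₀`, discount `γ` and reward `R`. -/
noncomputable def Vret {S A : Type*} [Fintype S] [Fintype A] (π : S → PMF A)
    (P : S × A → PMF S) (ρ₀ : PMF S) (γ : ℝ) (R : S × A → ℝ) : ℝ :=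
  ∑' t : ℕ, γ ^ t * ∑ sa : S × A, ((stateActionDist π P ρ₀ t) sa).toReal * R sa

section DTV

variable {α β : Type*} [Fintype α] [Fintype β]

theorem PMF.sum_toReal (p : PMF α) : ∑ x, (p x).toReal = 1 := by
  rw [← ENNReal.toReal_sum fun x _ => p.apply_ne_top x, ← tsum_fintype (L := .unconditional α),
    p.tsum_coe, ENNReal.toReal_one]

theorem PMF.toReal_bind_apply {β : Type*} (p : PMF α) (f : α → PMF β) (y : β) :
    (p.bind f y).toReal = ∑ x, (p x).toReal * (f x y).toReal := by
  rw [PMF.bind_apply, tsum_fintype, ENNReal.toReal_sum]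
  · simp only [ENNReal.toReal_mul]
  · exact fun x _ => ENNReal.mul_ne_top (p.apply_ne_top x) ((f x).apply_ne_top y)

theorem DTV_self (p : PMF α) : DTV p p = 0 := by
  simp [DTV]

theorem sum_abs_sub_eq_two_mul_DTV (p q : PMF α) :
    ∑ x, |(p x).toReal - (q x).toReal| = 2 * DTV p q := by
  unfold DTV
  ring

theorem DTV_bind_le (p q : PMF α) (f g : α → PMF β) {c : ℝ}
    (h : ∀ x, DTV (f x) (g x) ≤ c) :
    DTV (p.bind f) (q.bind g) ≤ DTV p q + c := by
  have key : ∑ y, |(p.bind f y).toReal - (q.bind g y).toReal| ≤ 2 * DTV p q + 2 * c := by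
    calc ∑ y, |(p.bind f y).toReal - (q.bind g y).toReal|
        ≤ ∑ y, ∑ x, ((p x).toReal * |(f x y).toReal - (g x y).toReal|
            + |(p x).toReal - (q x).toReal| * (g x y).toReal) := by
          refine Finset.sum_le_sum fun y _ => ?_
          rw [PMF.toReal_bind_apply, PMF.toReal_bind_apply, ← Finset.sum_sub_distrib]
          refine (Finset.abs_sum_le_sum_abs _ _).trans (Finset.sum_le_sum fun x _ => ?_)
          have hsplit : (p x).toReal * (f x y).toReal - (q x).toReal * (g x y).toReal
              = (p x).toReal * ((f x y).toReal - (g x y).toReal)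
                + ((p x).toReal - (q x).toReal) * (g x y).toReal := by ring
          rw [hsplit]
          refine (abs_add_le _ _).trans_eq ?_
          rw [abs_mul, abs_mul, abs_of_nonneg (a := (p x).toReal) ENNReal.toReal_nonneg,
            abs_of_nonneg (a := (g x y).toReal) ENNReal.toReal_nonneg]
      _ = ∑ x, ((p x).toReal * (2 * DTV (f x) (g x)) + |(p x).toReal - (q x).toReal|) := by
          rw [Finset.sum_comm]
          refine Finset.sum_congr rfl fun x _ => ?_
          rw [Finset.sum_add_distrib, ← Finset.mul_sum, ← Finset.mul_sum, PMF.sum_toReal,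
            sum_abs_sub_eq_two_mul_DTV, mul_one]
      _ ≤ ∑ x, ((p x).toReal * (2 * c) + |(p x).toReal - (q x).toReal|) := by
          gcongr with x
          exact h x
      _ = 2 * DTV p q + 2 * c := by
          rw [Finset.sum_add_distrib, ← Finset.sum_mul, PMF.sum_toReal,
            sum_abs_sub_eq_two_mul_DTV]
          ring
  rw [sum_abs_sub_eq_two_mul_DTV] at key
  linarith

theorem DTV_map_le (p q : PMF α) (f : α → β) : DTV (p.map f) (q.map f) ≤ DTV p q := by
  simpa [PMF.map] using
    DTV_bind_le p q (PMF.pure ∘ f) (PMF.pure ∘ f) fun x => (DTV_self _).le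

theorem abs_sum_toReal_mul_sub_le (p q : PMF α) (R : α → ℝ) {M : ℝ} (hR : ∀ x, |R x| ≤ M) :
    |∑ x, (p x).toReal * R x - ∑ x, (q x).toReal * R x| ≤ 2 * M * DTV p q := by
  rw [← Finset.sum_sub_distrib]
  calc |∑ x, ((p x).toReal * R x - (q x).toReal * R x)|
      ≤ ∑ x, |(p x).toReal * R x - (q x).toReal * R x| := Finset.abs_sum_le_sum_abs _ _
    _ ≤ ∑ x, |(p x).toReal - (q x).toReal| * M := by
        refine Finset.sum_le_sum fun x _ => ?_
        rw [← sub_mul, abs_mul]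
        gcongr
        exact hR x
    _ = 2 * M * DTV p q := by
        rw [← Finset.sum_mul, sum_abs_sub_eq_two_mul_DTV]
        ring

theorem abs_sum_toReal_mul_le (p : PMF α) (R : α → ℝ) {M : ℝ} (hR : ∀ x, |R x| ≤ M) :
    |∑ x, (p x).toReal * R x| ≤ M := by
  calc |∑ x, (p x).toReal * R x| ≤ ∑ x, |(p x).toReal * R x| := Finset.abs_sum_le_sum_abs _ _
    _ ≤ ∑ x, (p x).toReal * M := by
        refine Finset.sum_le_sum fun x _ => ?_
        rw [abs_mul, abs_of_nonneg (a := (p x).toReal) ENNReal.toReal_nonneg]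
        gcongr
        exact hR x
    _ = M := by rw [← Finset.sum_mul, PMF.sum_toReal, one_mul]

end DTV

section MDP

variable {S A : Type*} [Fintype S] [Fintype A]

/-- Replacing the policy costs at most `δ` in total variation at each step. -/
theorem DTV_stateActionDist_le (π₁ π₂ : S → PMF A) (P : S × A → PMF S) (ρ₀ : PMF S) {δ : ℝ}
    (h : ∀ s, DTV (π₁ s) (π₂ s) ≤ δ) (t : ℕ) :
    DTV (stateActionDist π₁ P ρ₀ t) (stateActionDist π₂ P ρ₀ t) ≤ (t + 1) * δ := by
  have step (ρ : PMF S) : DTV (ρ.bind fun s => (π₁ s).map fun a => (s, a))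
      (ρ.bind fun s => (π₂ s).map fun a => (s, a)) ≤ δ := by
    simpa [DTV_self] using DTV_bind_le ρ ρ _ _ fun s =>
      (DTV_map_le (π₁ s) (π₂ s) fun a => (s, a)).trans (h s)
  induction t with
  | zero => simpa [stateActionDist] using step ρ₀
  | succ t ih =>
    refine (DTV_bind_le _ _ _ _ fun sa => step (P sa)).trans ?_
    push_cast
    linarith

theorem summable_discounted_reward (π : S → PMF A) (P : S × A → PMF S) (ρ₀ : PMF S) {γ : ℝ}
    (hγ0 : 0 ≤ γ) (hγ1 : γ < 1) (R : S × A → ℝ) {M : ℝ} (hR : ∀ sa, |R sa| ≤ M) :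
    Summable fun t : ℕ =>
      γ ^ t * ∑ sa : S × A, ((stateActionDist π P ρ₀ t) sa).toReal * R sa := by
  refine Summable.of_norm_bounded ((summable_geometric_of_lt_one hγ0 hγ1).mul_right M)
    fun t => ?_
  rw [Real.norm_eq_abs, abs_mul, abs_of_nonneg (pow_nonneg hγ0 t)]
  gcongr
  exact abs_sum_toReal_mul_le _ R hR

end MDP

/-- **Return bound for two policies in the same environment**: the return gap is
controlled by the maximal total variation between the policies. -/
theorem return_bound_two_policies
    {S A : Type*} [Fintype S] [Nonempty S] [Fintype A] [Nonempty A]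
    (ρ₀ : PMF S) (γ : ℝ) (hγ0 : 0 ≤ γ) (hγ1 : γ < 1)
    (P : S × A → PMF S) (π₁ π₂ : S → PMF A)
    (R : S × A → ℝ) (Rmax : ℝ) (hRmax : 0 ≤ Rmax) (hR : ∀ sa, |R sa| ≤ Rmax) :
    |Vret π₁ P ρ₀ γ R - Vret π₂ P ρ₀ γ R| ≤
      2 * Rmax / (1 - γ) ^ 2 * ⨆ s, DTV (π₁ s) (π₂ s) := by
  set δ : ℝ := ⨆ s, DTV (π₁ s) (π₂ s)
  have hδ (s : S) : DTV (π₁ s) (π₂ s) ≤ δ :=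
    le_ciSup (f := fun s => DTV (π₁ s) (π₂ s)) (Set.finite_range _).bddAbove s
  have hgeom : HasSum (fun t : ℕ => 2 * Rmax * δ * ((t + 1) * γ ^ t))
      (2 * Rmax / (1 - γ) ^ 2 * δ) := by
    have hγ : ‖γ‖ < 1 := by rwa [Real.norm_eq_abs, abs_of_nonneg hγ0]
    have key := (hasSum_choose_mul_geometric_of_norm_lt_one 1 hγ).mul_left (2 * Rmax * δ)
    simp only [Nat.choose_one_right, Nat.cast_add, Nat.cast_one, one_add_one_eq_two] at key
    rwa [show 2 * Rmax / (1 - γ) ^ 2 * δ = 2 * Rmax * δ * (1 / (1 - γ) ^ 2) by ring]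
  unfold Vret
  rw [← (summable_discounted_reward π₁ P ρ₀ hγ0 hγ1 R hR).tsum_sub
    (summable_discounted_reward π₂ P ρ₀ hγ0 hγ1 R hR)]
  rw [← Real.norm_eq_abs]
  refine tsum_of_norm_bounded hgeom fun t => ?_
  rw [← mul_sub, Real.norm_eq_abs, abs_mul, abs_of_nonneg (pow_nonneg hγ0 t)]
  calc _ ≤ γ ^ t * (2 * Rmax * ((t + 1) * δ)) := by
        gcongr
        refine (abs_sum_toReal_mul_sub_le _ _ R hR).trans ?_
        gcongr
        exact DTV_stateActionDist_le π₁ π₂ P ρ₀ hδ t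
    _ = _ := by ring
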